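/- arXiv:2205.00236 — 7 statements merged into one kernel-verified Lean document; each statement's English description precedes it below -/
import Mathlib

section
/- For every instance with n ≥ 2 agents having nonnegative additive valuations over a finite set M of indivisible goods, normalized so that v_i(M) = 1 for every agent i, there exists a PROPavg allocation of M to the n agents. -/
open Finset
open scoped Classical

noncomputable section

variable {G : Type*}

/-- Value of a bundle under an additive valuation. -/
def val (v : G → ℝ) (S : Finset G) : ℝ := ∑ g ∈ S, v g

/-- Minimum value of a good in a bundle; `0` for the empty bundle. -/
def minval (v : G → ℝ) (S : Finset G) : ℝ :=
  if h : S.Nonempty then S.inf' h v else 0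

/-- `X` is a partition of the goods into `n` pairwise disjoint (possibly empty) bundles. -/
def IsAlloc {n : ℕ} (X : Fin n → Finset G) : Prop :=
  (∀ i j : Fin n, i ≠ j → Disjoint (X i) (X j)) ∧ (∀ g : G, ∃ i : Fin n, g ∈ X i)

/-- Agent `i` is PROPavg-satisfied by the allocation `X`. -/
def PROPavgSat {n : ℕ} (v : Fin n → G → ℝ) (X : Fin n → Finset G) (i : Fin n) : Prop :=
  val (v i) (X i) + (1 / ((n : ℝ) - 1)) * ∑ k ∈ Finset.univ.erase i, minval (v i) (X k)
    ≥ 1 / (n : ℝ)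

lemma val_nonneg {w : G → ℝ} (hw : ∀ g, 0 ≤ w g) (S : Finset G) : 0 ≤ val w S :=
  Finset.sum_nonneg fun g _ => hw g

lemma minval_nonneg {w : G → ℝ} (hw : ∀ g, 0 ≤ w g) (S : Finset G) : 0 ≤ minval w S := by
  unfold minval
  split_ifs with h
  · exact (Finset.le_inf'_iff h w).2 fun g _ => hw g
  · exact le_rfl

lemma minval_le_minval_of_subset {w : G → ℝ} {S T : Finset G} (hST : S ⊆ T) (hS : S.Nonempty) :
    minval w T ≤ minval w S := by
  unfold minval
  rw [dif_pos hS, dif_pos (hS.mono hST)]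
  exact Finset.inf'_mono w hST hS

lemma val_eq_minval_of_card_le_one {w : G → ℝ} {S : Finset G} (hS : S.card ≤ 1) :
    val w S = minval w S := by
  rcases S.eq_empty_or_nonempty with rfl | h
  · simp [_root_.val, minval]
  · obtain ⟨g, rfl⟩ := Finset.card_eq_one.1 (le_antisymm hS h.card_pos)
    simp [_root_.val, minval]

/-- Removing a least valued good from a bundle lowers its value by `minval`. -/
lemma exists_val_erase (w : G → ℝ) {S : Finset G} (hS : S.Nonempty) :
    ∃ g ∈ S, val w (S.erase g) = val w S - minval w S := by
  obtain ⟨g, hg, h⟩ := Finset.exists_mem_eq_inf' hS w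
  refine ⟨g, hg, ?_⟩
  rw [minval, dif_pos hS, h, _root_.val, _root_.val, ← Finset.add_sum_erase S w hg]
  ring

/-- A self-map of a nonempty finite set agrees with a permutation somewhere, and that
permutation fixes every point at which the two differ. -/
lemma exists_perm_eq_or_fixed {α : Type*} [Finite α] (f : α → α) (S : Finset α)
    (hS : S.Nonempty) (hf : ∀ i ∈ S, f i ∈ S) :
    ∃ π : Equiv.Perm α, (∀ j, π j = j ∨ (j ∈ S ∧ π j = f j)) ∧ ∃ i ∈ S, π i = f i := by
  induction hn : S.card using Nat.strong_induction_on generalizing S with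
  | _ m ih =>
    have hsub : S.image f ⊆ S := by
      intro x hx
      obtain ⟨i, hi, rfl⟩ := Finset.mem_image.1 hx
      exact hf i hi
    by_cases hc : (S.image f).card = S.card
    · have hinj : Set.InjOn f S := Finset.card_image_iff.1 hc
      let p : α → α := fun i => if i ∈ S then f i else i
      have hp : Function.Injective p := by
        intro i j hij
        by_cases hi : i ∈ S <;> by_cases hj : j ∈ S <;>
          simp only [p, hi, hj, if_true, if_false] at hij
        · exact hinj hi hj hij
        · exact absurd (hij ▸ hf i hi) hj
        · exact absurd (hij ▸ hf j hj) hi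
        · exact hij
      refine ⟨Equiv.ofBijective p (Finite.injective_iff_bijective.1 hp), fun j => ?_, ?_⟩
      · by_cases hj : j ∈ S
        · exact Or.inr ⟨hj, by simp [p, hj]⟩
        · exact Or.inl (by simp [p, hj])
      · obtain ⟨i, hi⟩ := hS
        exact ⟨i, hi, by simp [p, hi]⟩
    · have hlt : (S.image f).card < m :=
        hn ▸ lt_of_le_of_ne Finset.card_image_le hc
      obtain ⟨π, h1, i, hi, h2⟩ := ih _ hlt (S.image f) (hS.image f)
        (fun i hi => Finset.mem_image_of_mem f (hsub hi)) rfl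
      exact ⟨π, fun j => (h1 j).imp id fun h => ⟨hsub h.1, h.2⟩, i, hsub hi, h2⟩

/-- If every `i` is related to `some i`, then either all points can be matched injectively to
related ones while avoiding `k`, or some nonempty set is closed under the relation. -/
lemma exists_injective_avoiding_or_closed {α : Type*} [Fintype α] (L : α → Option α → Prop)
    (hL : ∀ i, L i (some i)) (k : Option α) :
    (∃ f : α → Option α, Function.Injective f ∧ ∀ i, f i ≠ k ∧ L i (f i)) ∨
    ∃ S : Finset α, S.Nonempty ∧ ∀ i ∈ S, ∀ x, L i x → ∃ j ∈ S, x = some j := by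
  let N : α → Finset (Option α) := fun i => Finset.univ.filter fun x => x ≠ k ∧ L i x
  by_cases hall : ∀ s : Finset α, s.card ≤ (s.biUnion N).card
  · obtain ⟨f, hf, hN⟩ := (Finset.all_card_le_biUnion_card_iff_exists_injective N).1 hall
    exact Or.inl ⟨f, hf, fun i => (Finset.mem_filter.1 (hN i)).2⟩
  · right
    push Not at hall
    obtain ⟨S, hS⟩ := hall
    have hsub : (S.image some).erase k ⊆ S.biUnion N := by
      intro x hx
      obtain ⟨hxk, hx⟩ := Finset.mem_erase.1 hx
      obtain ⟨i, hi, rfl⟩ := Finset.mem_image.1 hx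
      exact Finset.mem_biUnion.2 ⟨i, hi, Finset.mem_filter.2 ⟨Finset.mem_univ _, hxk, hL i⟩⟩
    have hcard : (S.image some).card = S.card :=
      Finset.card_image_of_injective S (Option.some_injective α)
    have hk : k ∈ S.image some := by
      by_contra hk
      rw [Finset.erase_eq_of_notMem hk] at hsub
      have := Finset.card_le_card hsub
      omega
    have heq : (S.image some).erase k = S.biUnion N := by
      refine Finset.eq_of_subset_of_card_le hsub ?_
      rw [Finset.card_erase_of_mem hk]
      omega
    refine ⟨S, Finset.card_pos.1 (by omega), fun i hi x hx => ?_⟩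
    have hmem : x ∈ S.image some := by
      by_cases hxk : x = k
      · exact hxk ▸ hk
      · refine Finset.mem_of_mem_erase (a := k) (heq ▸ ?_)
        exact Finset.mem_biUnion.2 ⟨i, hi, Finset.mem_filter.2 ⟨Finset.mem_univ _, hxk, hx⟩⟩
    obtain ⟨j, hj, rfl⟩ := Finset.mem_image.1 hmem
    exact ⟨j, hj, rfl⟩

/-- The goods outside all bundles of `X`. -/
def pool [Fintype G] {b : ℕ} (X : Fin b → Finset G) : Finset G :=
  Finset.univ \ Finset.univ.biUnion X

/-- The bundles of `X` together with the pool of remaining goods. -/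
def withPool [Fintype G] {b : ℕ} (X : Fin b → Finset G) : Option (Fin b) → Finset G
  | none => pool X
  | some k => X k

/-- Bundle `k` of `withPool X` is acceptable for `w`, with the pool's least good not counted;
the constants `1 / (n - 1)` and `1 / n` need not match the number of bundles. -/
def Accepts [Fintype G] (n : ℕ) {b : ℕ} (w : G → ℝ) (X : Fin b → Finset G) :
    Option (Fin b) → Prop
  | none => 1 / (n : ℝ) ≤ val w (pool X) + 1 / ((n : ℝ) - 1) * ∑ l, minval w (X l)
  | some k => 1 / (n : ℝ) ≤
      val w (X k) + 1 / ((n : ℝ) - 1) * (∑ l, minval w (X l) - minval w (X k))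

lemma sum_val_withPool [Fintype G] {b : ℕ} (w : G → ℝ) (X : Fin b → Finset G)
    (hX : Pairwise fun i j => Disjoint (X i) (X j)) :
    val w (pool X) + ∑ k, val w (X k) = val w Finset.univ := by
  have h : ∑ k, val w (X k) = val w (Finset.univ.biUnion X) :=
    (Finset.sum_biUnion fun i _ j _ hij => hX hij).symm
  rw [h]
  exact Finset.sum_sdiff (Finset.subset_univ _)

/-- If an agent accepts only bundles indexed by `S`, then one of those bundles has at least two
goods and stays acceptable after losing its least valued good. -/
lemma exists_acceptable_after_removal [Fintype G] {n b : ℕ} (hn : 2 ≤ n) (hb : b + 1 ≤ n)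
    {w : G → ℝ} (hw : ∀ g, 0 ≤ w g) (hw1 : val w Finset.univ = 1) {X : Fin b → Finset G}
    (hX : Pairwise fun i j => Disjoint (X i) (X j)) {S : Finset (Fin b)}
    (hS : ∀ x, Accepts n w X x → ∃ j ∈ S, x = some j) :
    ∃ l ∈ S, 1 < (X l).card ∧ 1 / (n : ℝ) ≤ val w (X l) - minval w (X l) +
      1 / ((n : ℝ) - 1) * (∑ k, minval w (X k) - minval w (X l)) := by
  have hn' : (2 : ℝ) ≤ n := by exact_mod_cast hn
  have hb' : (b : ℝ) + 1 ≤ n := by exact_mod_cast hb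
  set t : ℝ := 1 / (n : ℝ) with ht
  set c : ℝ := 1 / ((n : ℝ) - 1) with hc
  have hnt : n * t = 1 := by rw [ht]; field_simp
  have hnc : (n - 1) * c = 1 := by
    have : (n : ℝ) - 1 ≠ 0 := by linarith
    rw [hc]; field_simp
  have hc0 : 0 ≤ c := by rw [hc]; exact div_nonneg zero_le_one (by linarith)
  set m : Fin b → ℝ := fun k => minval w (X k) with hm
  have hm0 : ∀ k, 0 ≤ m k := fun k => minval_nonneg hw _
  set T : ℝ := ∑ k, m k with hT
  have hpool : val w (pool X) + c * T < t := by
    by_contra h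
    obtain ⟨j, -, hj⟩ := hS none (not_lt.1 h)
    cases hj
  have hcT : c * T < t := by linarith [val_nonneg hw (pool X)]
  by_contra hcon
  push Not at hcon
  have hbound : ∀ k, val w (X k) + c * (T - m k) ≤ t + m k := by
    intro k
    by_cases hk : k ∈ S
    · by_cases h1 : 1 < (X k).card
      · have := hcon k hk h1
        simp only [hm] at *
        linarith
      · have := val_eq_minval_of_card_le_one (w := w) (not_lt.1 h1)
        have h2 := mul_nonneg hc0 (hm0 k)
        simp only [hm] at *
        nlinarith
    · by_contra h
      obtain ⟨j, hj, hjk⟩ := hS (some k) (by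
        have := hm0 k
        show t ≤ val w (X k) + c * (T - m k)
        linarith)
      cases hjk
      exact hk hj
  have hsum := Finset.sum_le_sum fun k (_ : k ∈ (Finset.univ : Finset (Fin b))) => hbound k
  simp only [Finset.sum_add_distrib, ← Finset.mul_sum, Finset.sum_sub_distrib, Finset.sum_const,
    Finset.card_univ, Fintype.card_fin, nsmul_eq_mul, ← hT] at hsum
  have htot := sum_val_withPool w X hX
  have hprod := mul_le_mul_of_nonneg_left hcT.le (show (0 : ℝ) ≤ n - (b + 1) by linarith)
  have hT' : (n - 1) * c * T = T := by rw [hnc, one_mul]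
  linarith

/-- A state in which some set of agents accepts only its own bundles can be improved to one with
fewer goods outside the pool. -/
lemma exists_smaller_of_closed [Fintype G] {n b : ℕ} (hn : 2 ≤ n) (hb : b + 1 ≤ n)
    {v : Fin b → G → ℝ} (hv : ∀ i g, 0 ≤ v i g) (hv1 : ∀ i, val (v i) Finset.univ = 1)
    {X : Fin b → Finset G} (hX : Pairwise fun i j => Disjoint (X i) (X j))
    (hacc : ∀ i, Accepts n (v i) X (some i)) {S : Finset (Fin b)} (hS : S.Nonempty)
    (hclosed : ∀ i ∈ S, ∀ x, Accepts n (v i) X x → ∃ j ∈ S, x = some j) :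
    ∃ X' : Fin b → Finset G, (Pairwise fun i j => Disjoint (X' i) (X' j)) ∧
      (∀ i, Accepts n (v i) X' (some i)) ∧ ∑ i, (X' i).card < ∑ i, (X i).card := by
  have hc0 : (0 : ℝ) ≤ 1 / ((n : ℝ) - 1) := by
    have hn' : (2 : ℝ) ≤ n := by exact_mod_cast hn
    exact div_nonneg zero_le_one (by linarith)
  have hstrong : ∀ i, ∃ l, i ∈ S → l ∈ S ∧ 1 < (X l).card ∧
      1 / (n : ℝ) ≤ val (v i) (X l) - minval (v i) (X l) +
        1 / ((n : ℝ) - 1) * (∑ k, minval (v i) (X k) - minval (v i) (X l)) := by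
    intro i
    by_cases hi : i ∈ S
    · obtain ⟨l, hl⟩ :=
        exists_acceptable_after_removal hn hb (hv i) (hv1 i) hX (hclosed i hi)
      exact ⟨l, fun _ => hl⟩
    · exact ⟨i, fun h => absurd h hi⟩
  choose f hf using hstrong
  obtain ⟨π, hπ, i₀, hi₀, hπi₀⟩ := exists_perm_eq_or_fixed f S hS fun i hi => (hf i hi).1
  obtain ⟨-, hcard, hst⟩ := hf i₀ hi₀
  have hne : (X (f i₀)).Nonempty := Finset.card_pos.1 (by omega)
  obtain ⟨g, hg, hval⟩ := exists_val_erase (v i₀) hne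
  have hne' : ((X (f i₀)).erase g).Nonempty :=
    Finset.card_pos.1 (by rw [Finset.card_erase_of_mem hg]; omega)
  set Z : Fin b → Finset G := Function.update X (f i₀) ((X (f i₀)).erase g) with hZ
  have hZl : Z (f i₀) = (X (f i₀)).erase g := by simp [hZ]
  have hZk : ∀ k, k ≠ f i₀ → Z k = X k := fun k hk => by simp [hZ, hk]
  have hZsub : ∀ k, Z k ⊆ X k := by
    intro k
    by_cases hk : k = f i₀
    · subst hk; rw [hZl]; exact Finset.erase_subset _ _
    · rw [hZk k hk]
  have hmin : ∀ w : G → ℝ, ∀ k, minval w (X k) ≤ minval w (Z k) := by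
    intro w k
    by_cases hk : k = f i₀
    · subst hk; rw [hZl]; exact minval_le_minval_of_subset (Finset.erase_subset _ _) hne'
    · rw [hZk k hk]
  refine ⟨fun i => Z (π i), fun i j hij => ?_, fun i => ?_, ?_⟩
  · exact (hX (π.injective.ne hij)).mono (hZsub _) (hZsub _)
  · show 1 / (n : ℝ) ≤ val (v i) (Z (π i)) +
      1 / ((n : ℝ) - 1) * (∑ l, minval (v i) (Z (π l)) - minval (v i) (Z (π i)))
    rw [Equiv.sum_comp π fun l => minval (v i) (Z l),
      ← Finset.add_sum_erase _ _ (Finset.mem_univ (π i)), add_sub_cancel_left]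
    have hold : 1 / (n : ℝ) ≤ val (v i) (Z (π i)) + 1 / ((n : ℝ) - 1) *
        ∑ l ∈ Finset.univ.erase (π i), minval (v i) (X l) := by
      have hsum := Finset.add_sum_erase Finset.univ (fun l => minval (v i) (X l))
        (Finset.mem_univ (π i))
      have hsum' : ∑ l ∈ Finset.univ.erase (π i), minval (v i) (X l) =
          ∑ l, minval (v i) (X l) - minval (v i) (X (π i)) := by
        rw [← hsum]; ring
      rw [hsum']
      by_cases hi : i = i₀
      · subst hi
        rw [hπi₀, hZl, hval]
        exact hst
      · rw [hZk _ fun h => hi (π.injective (h.trans hπi₀.symm))]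
        rcases hπ i with h | ⟨hiS, h⟩
        · rw [h]; exact hacc i
        · rw [h]
          linarith [(hf i hiS).2.2, minval_nonneg (hv i) (X (f i))]
    exact hold.trans (by gcongr with l; exact hmin _ _)
  · rw [Equiv.sum_comp π fun l => (Z l).card]
    refine Finset.sum_lt_sum (fun k _ => Finset.card_le_card (hZsub k))
      ⟨f i₀, Finset.mem_univ _, ?_⟩
    rw [hZl]
    exact Finset.card_erase_lt_of_mem hg

/-- A state in which every agent accepts its bundle can be chosen so that, whichever bundle
(pool included) is taken away, the agents can be matched to accepted bundles. -/
lemma exists_matchable_state [Fintype G] {n b : ℕ} (hn : 2 ≤ n) (hb : b + 1 ≤ n)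
    {v : Fin b → G → ℝ} (hv : ∀ i g, 0 ≤ v i g) (hv1 : ∀ i, val (v i) Finset.univ = 1)
    {X : Fin b → Finset G} (hX : Pairwise fun i j => Disjoint (X i) (X j))
    (hacc : ∀ i, Accepts n (v i) X (some i)) :
    ∃ X' : Fin b → Finset G, (Pairwise fun i j => Disjoint (X' i) (X' j)) ∧
      ∀ k, ∃ f : Fin b → Option (Fin b), Function.Injective f ∧
        ∀ i, f i ≠ k ∧ Accepts n (v i) X' (f i) := by
  induction hN : ∑ i, (X i).card using Nat.strong_induction_on generalizing X with
  | _ N ih =>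
    by_cases h : ∃ S : Finset (Fin b), S.Nonempty ∧
        ∀ i ∈ S, ∀ x, Accepts n (v i) X x → ∃ j ∈ S, x = some j
    · obtain ⟨S, hS, hclosed⟩ := h
      obtain ⟨X', hX', hacc', hlt⟩ := exists_smaller_of_closed hn hb hv hv1 hX hacc hS hclosed
      exact ih _ (hN ▸ hlt) hX' hacc' rfl
    · exact ⟨X, hX, fun k =>
        (exists_injective_avoiding_or_closed (fun i => Accepts n (v i) X) hacc k).resolve_right h⟩

lemma disjoint_withPool [Fintype G] {b : ℕ} {X : Fin b → Finset G}
    (hX : Pairwise fun i j => Disjoint (X i) (X j)) :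
    Pairwise fun x y => Disjoint (withPool X x) (withPool X y) := by
  have hp : ∀ k, Disjoint (pool X) (X k) := fun k =>
    Finset.sdiff_disjoint.mono_right (Finset.subset_biUnion_of_mem X (Finset.mem_univ k))
  rintro (_ | i) (_ | j) hij
  · exact absurd rfl hij
  · exact hp j
  · exact (hp i).symm
  · exact hX fun h => hij (congrArg some h)

lemma exists_mem_withPool [Fintype G] {b : ℕ} (X : Fin b → Finset G) (g : G) :
    ∃ x, g ∈ withPool X x := by
  by_cases h : ∃ k, g ∈ X k
  · exact ⟨some h.choose, h.choose_spec⟩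
  · exact ⟨none, by simpa [withPool, pool] using h⟩

/-- Adding an agent, who picks a best bundle of a matchable state. -/
lemma exists_alloc_succ [Fintype G] {n b : ℕ} (hn : 2 ≤ n) (hb : b + 1 ≤ n)
    {v : Fin (b + 1) → G → ℝ} (hv : ∀ i g, 0 ≤ v i g) (hv1 : ∀ i, val (v i) Finset.univ = 1)
    {X : Fin b → Finset G} (hX : Pairwise fun i j => Disjoint (X i) (X j))
    (hacc : ∀ i : Fin b, Accepts n (v i.succ) X (some i)) :
    ∃ Y : Fin (b + 1) → Finset G, IsAlloc Y ∧ ∀ i, Accepts n (v i) Y (some i) := by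
  have hn' : (2 : ℝ) ≤ n := by exact_mod_cast hn
  have hb' : (b : ℝ) + 1 ≤ n := by exact_mod_cast hb
  have hc0 : (0 : ℝ) ≤ 1 / ((n : ℝ) - 1) := div_nonneg zero_le_one (by linarith)
  obtain ⟨X', hX', hmatch⟩ :=
    exists_matchable_state hn hb (fun i => hv i.succ) (fun i => hv1 i.succ) hX hacc
  obtain ⟨k, -, hk⟩ := Finset.exists_max_image Finset.univ
    (fun x => val (v 0) (withPool X' x)) Finset.univ_nonempty
  have hk1 : 1 / (n : ℝ) ≤ val (v 0) (withPool X' k) := by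
    have h1 := Finset.sum_le_card_nsmul Finset.univ
      (fun x => val (v 0) (withPool X' x)) _ hk
    rw [Fintype.sum_option] at h1
    have h2 := sum_val_withPool (v 0) X' hX'
    rw [hv1 0] at h2
    simp only [Finset.card_univ, Fintype.card_option, Fintype.card_fin, nsmul_eq_mul,
      Nat.cast_add, Nat.cast_one] at h1
    rw [div_le_iff₀ (by linarith)]
    have h3 : (1 : ℝ) ≤ ((b : ℝ) + 1) * val (v 0) (withPool X' k) := h2.symm.trans_le h1
    nlinarith [val_nonneg (hv 0) (withPool X' k)]
  obtain ⟨f, hf, hfk⟩ := hmatch k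
  have hinj : Function.Injective (Fin.cons k f : Fin (b + 1) → Option (Fin b)) :=
    Fin.cons_injective_iff.2 ⟨fun ⟨i, hi⟩ => (hfk i).1 hi, hf⟩
  let e : Fin (b + 1) ≃ Option (Fin b) := Equiv.ofBijective _
    ((Fintype.bijective_iff_injective_and_card _).2 ⟨hinj, by simp⟩)
  have he0 : e 0 = k := rfl
  have hes : ∀ i : Fin b, e i.succ = f i := fun i => rfl
  refine ⟨fun i => withPool X' (e i),
    ⟨fun i j hij => disjoint_withPool hX' (e.injective.ne hij), fun g => ?_⟩, fun i => ?_⟩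
  · obtain ⟨x, hx⟩ := exists_mem_withPool X' g
    exact ⟨e.symm x, by simpa using hx⟩
  · show 1 / (n : ℝ) ≤ val (v i) (withPool X' (e i)) + 1 / ((n : ℝ) - 1) *
      (∑ l, minval (v i) (withPool X' (e l)) - minval (v i) (withPool X' (e i)))
    rw [Equiv.sum_comp e fun x => minval (v i) (withPool X' x)]
    have hsingle := Finset.single_le_sum
      (fun x _ => minval_nonneg (hv i) (withPool X' x)) (Finset.mem_univ (e i))
    have hp := minval_nonneg (hv i) (pool X')
    refine Fin.cases (motive := fun j => j = i → _) (fun hi => ?_) (fun j hi => ?_) i rfl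
    · subst hi
      rw [he0] at hsingle ⊢
      have := mul_nonneg hc0 (sub_nonneg.2 hsingle)
      linarith
    · subst hi
      have h := (hfk j).2
      rw [hes, Fintype.sum_option]
      rcases hfj : f j with _ | l <;> rw [hfj] at h
      · refine le_trans (show _ ≤ _ from h) (le_of_eq ?_)
        simp only [withPool, add_sub_cancel_left]
      · refine le_trans (show _ ≤ _ from h) ?_
        simp only [withPool]
        gcongr
        linarith

lemma exists_accepted_state [Fintype G] {n b : ℕ} (hn : 2 ≤ n) (hb : b ≤ n)
    {v : Fin b → G → ℝ} (hv : ∀ i g, 0 ≤ v i g) (hv1 : ∀ i, val (v i) Finset.univ = 1) :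
    ∃ X : Fin b → Finset G, (Pairwise fun i j => Disjoint (X i) (X j)) ∧
      ∀ i, Accepts n (v i) X (some i) := by
  induction b with
  | zero => exact ⟨fun _ => ∅, fun i => i.elim0, fun i => i.elim0⟩
  | succ b ih =>
    obtain ⟨X, hX, hacc⟩ := ih (by omega) (v := fun i => v i.succ) (fun i => hv i.succ)
      fun i => hv1 i.succ
    obtain ⟨Y, hY, hYacc⟩ := exists_alloc_succ hn hb hv hv1 hX hacc
    exact ⟨Y, fun i j hij => hY.1 i j hij, hYacc⟩

/-- Existence of a PROPavg allocation for `n ≥ 2` agents with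
nonnegative additive valuations normalized so that `vᵢ(M) = 1`. -/
theorem propavg_exists {G : Type*} [Fintype G] (n : ℕ) (hn : 2 ≤ n)
    (v : Fin n → G → ℝ)
    (hpos : ∀ (i : Fin n) (g : G), 0 ≤ v i g)
    (hnorm : ∀ i : Fin n, val (v i) (Finset.univ : Finset G) = 1) :
    ∃ X : Fin n → Finset G, IsAlloc X ∧ ∀ i : Fin n, PROPavgSat v X i := by
  obtain ⟨b, rfl⟩ : ∃ b, n = b + 1 := ⟨n - 1, by omega⟩
  obtain ⟨X, hX, hacc⟩ := exists_accepted_state hn (Nat.le_succ b)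
    (v := fun i => v i.succ) (fun i => hpos i.succ) fun i => hnorm i.succ
  obtain ⟨Y, hY, hYacc⟩ := exists_alloc_succ hn le_rfl hpos hnorm hX hacc
  refine ⟨Y, hY, fun i => ?_⟩
  have h : 1 / ((b + 1 : ℕ) : ℝ) ≤ val (v i) (Y i) + 1 / (((b + 1 : ℕ) : ℝ) - 1) *
      (∑ l, minval (v i) (Y l) - minval (v i) (Y i)) := hYacc i
  rw [← Finset.add_sum_erase _ _ (Finset.mem_univ i), add_sub_cancel_left] at h
  exact h
end
end

section
/- Let X = (X_u)_{u∈V_2} be an allocation to V_2 with n ≥ 2 and let i ∈ V_1 be an agent such that (i, r) is not an edge of the PROPavg-graph G_X. Then for every u ∈ V_2 such that (i, u) is an edge of G_X, the bundle X_u is nonempty. -/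
open Finset
open scoped Classical

noncomputable section

variable {G : Type*}

/-- Edge of the PROPavg-graph between agent `i ∈ V₁` and label `u ∈ V₂` (both parts
are indexed by `Fin n`, `r` is the distinguished element of `V₂`). -/
def Edge {n : ℕ} (v : Fin n → G → ℝ) (X : Fin n → Finset G) (r i u : Fin n) : Prop :=
  val (v i) (X u) + (1 / ((n : ℝ) - 1)) *
      ∑ u' ∈ (Finset.univ.erase r).erase u, minval (v i) (X u')
    ≥ 1 / (n : ℝ)

/-- `i` is one of the agents `1, …, n-1`, i.e. not the last agent. -/
def InV1 {n : ℕ} (i : Fin n) : Prop := (i : ℕ) < n - 1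

/-- The set `V₁` of the first `n-1` agents. -/
def V1 (n : ℕ) : Finset (Fin n) := Finset.univ.filter fun i => (i : ℕ) < n - 1

/-- A perfect matching of `V₁` onto `V₂ \ {u}` in the PROPavg-graph `G_X`,
i.e. a bijection from `V₁` to `V₂ \ {u}` all of whose pairs are edges. -/
def IsPM {n : ℕ} (v : Fin n → G → ℝ) (X : Fin n → Finset G) (r u : Fin n)
    (f : Fin n → Fin n) : Prop :=
  Set.InjOn f {i : Fin n | InV1 i} ∧
  (∀ i : Fin n, InV1 i → f i ≠ u ∧ Edge v X r i (f i)) ∧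
  (∀ w : Fin n, w ≠ u → ∃ i : Fin n, InV1 i ∧ f i = w)

/-- Property (P1): `G_X - r` has a perfect matching. -/
def P1 {n : ℕ} (v : Fin n → G → ℝ) (X : Fin n → Finset G) (r : Fin n) : Prop :=
  ∃ f : Fin n → Fin n, IsPM v X r r f

/-- Property (P2): for every `u ∈ V₂`, `G_X - u` has a perfect matching. -/
def P2 {n : ℕ} (v : Fin n → G → ℝ) (X : Fin n → Finset G) (r : Fin n) : Prop :=
  ∀ u : Fin n, ∃ f : Fin n → Fin n, IsPM v X r u f

/-- The neighborhood `Γ_{G_X}(S) ⊆ V₂` of a set `S ⊆ V₁` in the PROPavg-graph. -/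
def Nbr {n : ℕ} (v : Fin n → G → ℝ) (X : Fin n → Finset G) (r : Fin n)
    (S : Finset (Fin n)) : Finset (Fin n) :=
  Finset.univ.filter fun u => ∃ i ∈ S, Edge v X r i u

/-- The allocation obtained from `X` by moving the good `g ∈ X ustar` to `X r`. -/
def move {n : ℕ} [DecidableEq G] (X : Fin n → Finset G) (r ustar : Fin n) (g : G) :
    Fin n → Finset G :=
  fun u => if u = r then insert g (X r) else if u = ustar then (X ustar).erase g else X u

/-- if `(i, r)` is not an edge, every bundle `X u` with `(i, u)` an edge
is nonempty. -/
theorem edge_bundle_nonempty {G : Type*} [Fintype G] (n : ℕ) (hn : 2 ≤ n)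
    (v : Fin n → G → ℝ) (X : Fin n → Finset G) (r : Fin n)
    (hpos : ∀ (i : Fin n) (g : G), 0 ≤ v i g)
    (hnorm : ∀ i : Fin n, val (v i) (Finset.univ : Finset G) = 1)
    (hX : IsAlloc X)
    (i : Fin n) (hi : InV1 i) (hir : ¬ Edge v X r i r) :
    ∀ u : Fin n, Edge v X r i u → (X u).Nonempty := by
  intro u hu
  by_contra hne
  have hempty : X u = ∅ := Finset.not_nonempty_iff_eq_empty.mp hne
  have hmin : minval (v i) (X u) = 0 := by simp [minval, hempty]
  have hval : 0 ≤ val (v i) (X r) := Finset.sum_nonneg fun g _ => hpos i g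
  apply hir
  unfold Edge at hu ⊢
  rw [Finset.sum_erase (f := fun w => minval (v i) (X w)) _ hmin] at hu
  rw [Finset.erase_eq_of_notMem (Finset.notMem_erase r _)]
  have hzero : val (v i) (X u) = 0 := by simp [_root_.val, hempty]
  linarith
end
end

section
/- Let X = (X_u)_{u∈V_2} be an allocation to V_2 satisfying (P1), and let S ⊆ V_1 be a nonempty set with |Γ_{G_X}(S)| ≤ |S|. Then r ∉ Γ_{G_X}(S), i.e., (i, r) is not an edge of G_X for any i ∈ S; moreover |Γ_{G_X − r}(S)| = |S|. -/
open Finset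
open scoped Classical

noncomputable section

variable {G : Type*}

/-- Claim 2 in Proposition 1: under (P1), a nonempty `S ⊆ V₁` with
`|Γ(S)| ≤ |S|` has no edge to `r`, and `|Γ_{G_X - r}(S)| = |S|`. -/
theorem tight_set_avoids_r {G : Type*} [Fintype G] (n : ℕ) (hn : 2 ≤ n)
    (v : Fin n → G → ℝ) (X : Fin n → Finset G) (r : Fin n)
    (hpos : ∀ (i : Fin n) (g : G), 0 ≤ v i g)
    (hnorm : ∀ i : Fin n, val (v i) (Finset.univ : Finset G) = 1)
    (hX : IsAlloc X)
    (hP1 : P1 v X r)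
    (S : Finset (Fin n)) (hS : S ⊆ V1 n) (hSne : S.Nonempty)
    (hcard : (Nbr v X r S).card ≤ S.card) :
    r ∉ Nbr v X r S ∧ (∀ i ∈ S, ¬ Edge v X r i r) ∧
      ((Nbr v X r S).erase r).card = S.card := by
  obtain ⟨f, hinj, hedge, -⟩ := hP1
  have hmem : ∀ i ∈ S, InV1 i := fun i hi => (Finset.mem_filter.mp (hS hi)).2
  have hsub : S.image f ⊆ (Nbr v X r S).erase r := by
    intro u hu
    obtain ⟨i, hi, rfl⟩ := Finset.mem_image.mp hu
    obtain ⟨hne, he⟩ := hedge i (hmem i hi)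
    exact Finset.mem_erase.mpr ⟨hne, Finset.mem_filter.mpr ⟨Finset.mem_univ _, i, hi, he⟩⟩
  have hle : S.card ≤ ((Nbr v X r S).erase r).card := by
    rw [← Finset.card_image_of_injOn (hinj.mono hmem)]
    exact Finset.card_le_card hsub
  have hr : r ∉ Nbr v X r S := fun h =>
    absurd (Finset.card_erase_lt_of_mem h) (hcard.trans hle).not_gt
  refine ⟨hr, fun i hi he => hr (Finset.mem_filter.mpr ⟨Finset.mem_univ _, i, hi, he⟩), ?_⟩
  exact le_antisymm ((Finset.card_le_card (Finset.erase_subset _ _)).trans hcard) hle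
end
end

section
/- Let X = (X_u)_{u∈V_2} be an allocation to V_2 satisfying (P1), and let S* ⊆ V_1 be a nonempty set with |Γ_{G_X}(S*)| ≤ |S*| such that every nonempty proper subset S ⊊ S* satisfies |Γ_{G_X}(S)| ≥ |S| + 1. Then every nonempty proper subset S ⊊ S* satisfies |S| + 1 ≤ |Γ_{G_X − r}(S)|. -/
open Finset
open scoped Classical

noncomputable section

variable {G : Type*}

/-- Claim 3 in Proposition 1: under (P1), for a minimal tight set `S*`,
every nonempty proper subset `S ⊊ S*` satisfies `|S| + 1 ≤ |Γ_{G_X - r}(S)|`. -/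
theorem proper_subsets_expand_minus_r {G : Type*} [Fintype G] (n : ℕ) (hn : 2 ≤ n)
    (v : Fin n → G → ℝ) (X : Fin n → Finset G) (r : Fin n)
    (hpos : ∀ (i : Fin n) (g : G), 0 ≤ v i g)
    (hnorm : ∀ i : Fin n, val (v i) (Finset.univ : Finset G) = 1)
    (hX : IsAlloc X)
    (hP1 : P1 v X r)
    (Sstar : Finset (Fin n)) (hsub : Sstar ⊆ V1 n) (hne : Sstar.Nonempty)
    (hcard : (Nbr v X r Sstar).card ≤ Sstar.card)
    (hmin : ∀ S : Finset (Fin n), S ⊂ Sstar → S.Nonempty →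
      S.card + 1 ≤ (Nbr v X r S).card) :
    ∀ S : Finset (Fin n), S ⊂ Sstar → S.Nonempty →
      S.card + 1 ≤ ((Nbr v X r S).erase r).card := by
  obtain ⟨f, hinj, hedge, -⟩ := hP1
  have hV1 : ∀ i ∈ Sstar, InV1 i := fun i hi => (Finset.mem_filter.mp (hsub hi)).2
  -- The matching embeds `Sstar` into its neighborhood without `r`.
  have hle : Sstar.card ≤ ((Nbr v X r Sstar).erase r).card :=
    Finset.card_le_card_of_injOn f
      (fun i hi => Finset.mem_erase.mpr ⟨(hedge i (hV1 i hi)).1,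
        Finset.mem_filter.mpr ⟨Finset.mem_univ _, i, hi, (hedge i (hV1 i hi)).2⟩⟩)
      (fun i hi j hj h => hinj (hV1 i hi) (hV1 j hj) h)
  have hr : r ∉ Nbr v X r Sstar := fun h =>
    absurd (Finset.card_erase_lt_of_mem h) (not_lt.mpr (hcard.trans hle))
  intro S hS hSne
  have hrS : r ∉ Nbr v X r S := by
    intro h
    obtain ⟨-, i, hi, hir⟩ := Finset.mem_filter.mp h
    exact hr (Finset.mem_filter.mpr ⟨Finset.mem_univ _, i, hS.1 hi, hir⟩)
  rw [Finset.erase_eq_of_notMem hrS]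
  exact hmin S hS hSne
end
end

section
/- Let X = (X_u)_{u∈V_2} be an allocation to V_2 satisfying (P1), and let S* ⊆ V_1 be a nonempty set with |Γ_{G_X}(S*)| ≤ |S*| such that every nonempty proper subset S ⊊ S* satisfies |Γ_{G_X}(S)| ≥ |S| + 1. Then for any i ∈ S* and any u ∈ Γ_{G_X}(S*) such that (i, u) is an edge of G_X, the graph G_X − r has a perfect matching in which i is matched to u. -/
open Finset
open scoped Classical

noncomputable section

variable {G : Type*}

/-- Let `f` match `A` injectively along the relation `E`, and let `S ⊆ A` have at most `#S`
neighbors while every nonempty proper subset of `S` has a surplus of neighbors. Then every edge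
`(i, u)` with `i ∈ S` lies in a matching of `A` with the same image as `f`. -/
theorem exists_injOn_image_eq_of_tight {α β : Type*} [Fintype β] (E : α → β → Prop)
    (A S : Finset α) (f : α → β) (hinj : Set.InjOn f A) (hf : ∀ a ∈ A, E a (f a))
    (hSA : S ⊆ A) (hcard : #{b | ∃ a ∈ S, E a b} ≤ #S)
    (hmin : ∀ T ⊂ S, T.Nonempty → #T + 1 ≤ #{b | ∃ a ∈ T, E a b})
    {i : α} (hi : i ∈ S) {u : β} (hiu : E i u) :
    ∃ g : α → β, Set.InjOn g A ∧ (∀ a ∈ A, E a (g a)) ∧ g '' A = f '' A ∧ g i = u := by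
  have himage : S.image f = ({b | ∃ a ∈ S, E a b} : Finset β) := by
    apply Finset.eq_of_subset_of_card_le
    · intro b hb
      obtain ⟨a, ha, rfl⟩ := Finset.mem_image.1 hb
      exact Finset.mem_filter.2 ⟨Finset.mem_univ _, a, ha, hf a (hSA ha)⟩
    · rwa [Finset.card_image_of_injOn (hinj.mono (by exact_mod_cast hSA))]
  have hmem : ∀ a ∈ S, ∀ b, E a b → ∃ a' ∈ S, f a' = b := fun a ha b hab =>
    Finset.mem_image.1 (himage ▸ Finset.mem_filter.2 ⟨Finset.mem_univ _, a, ha, hab⟩)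
  obtain ⟨h, hhinj, hh⟩ := (Finset.all_card_le_biUnion_card_iff_exists_injective
    fun a : {a // a ∈ S.erase i} => ({b | E a b} : Finset β).erase u).1 (by
      intro T
      rcases T.eq_empty_or_nonempty with rfl | hT
      · simp
      have hss : T.map (Function.Embedding.subtype _) ⊂ S := by
        refine Finset.ssubset_of_subset_of_ssubset (fun a ha => ?_) (Finset.erase_ssubset hi)
        obtain ⟨x, -, rfl⟩ := Finset.mem_map.1 ha
        exact x.2
      have hlt := hmin _ hss (hT.map)
      have heq : (T.biUnion fun a => ({b | E a b} : Finset β).erase u) =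
          ({b | ∃ a ∈ T.map (Function.Embedding.subtype _), E a b} : Finset β).erase u := by
        ext b
        simp only [Finset.mem_biUnion, Finset.mem_erase, Finset.mem_filter, Finset.mem_univ,
          true_and, Finset.mem_map, Function.Embedding.coe_subtype]
        aesop
      rw [heq]
      rw [Finset.card_map] at hlt
      exact (Nat.le_sub_of_add_le hlt).trans Finset.pred_card_le_card_erase)
  simp only [Finset.mem_erase, Finset.mem_filter, Finset.mem_univ, true_and] at hh
  let g : α → β := fun a =>
    if ha : a ∈ S.erase i then h ⟨a, ha⟩ else if a = i then u else f a
  have hgi : g i = u := by simp [g]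
  have hgS : ∀ a (ha : a ∈ S.erase i), g a = h ⟨a, ha⟩ := fun a ha => dif_pos ha
  have hgf : ∀ a, a ∉ S → g a = f a := by
    intro a ha
    have hai : a ≠ i := fun h => ha (h ▸ hi)
    simp [g, ha, hai]
  have hgE : ∀ a ∈ A, E a (g a) := by
    intro a ha
    by_cases haS : a ∈ S
    · by_cases hai : a = i
      · rw [hai, hgi]
        exact hiu
      · rw [hgS a (Finset.mem_erase.2 ⟨hai, haS⟩)]
        exact (hh ⟨a, _⟩).2
    · rw [hgf a haS]
      exact hf a ha
  have hgmem : ∀ a ∈ S, ∃ a' ∈ S, f a' = g a := fun a ha => hmem a ha _ (hgE a (hSA ha))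
  have hne : ∀ a ∈ S, ∀ b ∈ A, b ∉ S → g a ≠ g b := by
    intro a ha b hb hbS hab
    obtain ⟨c, hc, hca⟩ := hgmem a ha
    rw [hab, hgf b hbS] at hca
    exact hbS (hinj (hSA hc) hb hca ▸ hc)
  have hginj : Set.InjOn g A := by
    intro a ha b hb hab
    by_cases haS : a ∈ S <;> by_cases hbS : b ∈ S
    · by_cases hai : a = i <;> by_cases hbi : b = i
      · rw [hai, hbi]
      · rw [hai, hgi, hgS b (Finset.mem_erase.2 ⟨hbi, hbS⟩)] at hab
        exact absurd hab.symm (hh _).1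
      · rw [hbi, hgi, hgS a (Finset.mem_erase.2 ⟨hai, haS⟩)] at hab
        exact absurd hab (hh _).1
      · rw [hgS a (Finset.mem_erase.2 ⟨hai, haS⟩), hgS b (Finset.mem_erase.2 ⟨hbi, hbS⟩)] at hab
        exact congrArg Subtype.val (hhinj hab)
    · exact absurd hab (hne a haS b hb hbS)
    · exact absurd hab.symm (hne b hbS a ha haS)
    · rw [hgf a haS, hgf b hbS] at hab
      exact hinj ha hb hab
  have hAimage : A.image g = A.image f := by
    refine Finset.eq_of_subset_of_card_le (fun b hb => ?_) ?_
    · obtain ⟨a, ha, rfl⟩ := Finset.mem_image.1 hb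
      by_cases haS : a ∈ S
      · obtain ⟨c, hc, hca⟩ := hgmem a haS
        exact Finset.mem_image.2 ⟨c, hSA hc, hca⟩
      · exact Finset.mem_image.2 ⟨a, ha, (hgf a haS).symm⟩
    · rw [Finset.card_image_of_injOn hginj, Finset.card_image_of_injOn hinj]
  exact ⟨g, hginj, hgE, by simpa using congrArg (fun B : Finset β => (B : Set β)) hAimage, hgi⟩

/-- Claim 4 in Proposition 1: under (P1), for a minimal tight set `S*`,
any edge `(i, u)` with `i ∈ S*` and `u ∈ Γ(S*)` extends to a perfect matching of
`G_X - r` in which `i` is matched to `u`. -/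
theorem matching_through_edge {G : Type*} [Fintype G] (n : ℕ) (hn : 2 ≤ n)
    (v : Fin n → G → ℝ) (X : Fin n → Finset G) (r : Fin n)
    (hpos : ∀ (i : Fin n) (g : G), 0 ≤ v i g)
    (hnorm : ∀ i : Fin n, val (v i) (Finset.univ : Finset G) = 1)
    (hX : IsAlloc X)
    (hP1 : P1 v X r)
    (Sstar : Finset (Fin n)) (hsub : Sstar ⊆ V1 n) (hne : Sstar.Nonempty)
    (hcard : (Nbr v X r Sstar).card ≤ Sstar.card)
    (hmin : ∀ S : Finset (Fin n), S ⊂ Sstar → S.Nonempty →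
      S.card + 1 ≤ (Nbr v X r S).card) :
    ∀ i ∈ Sstar, ∀ u ∈ Nbr v X r Sstar, Edge v X r i u →
      ∃ f : Fin n → Fin n, IsPM v X r r f ∧ f i = u := by
  intro i hi u _ hiu
  obtain ⟨f, hfinj, hf, hfsurj⟩ := hP1
  have hV : ∀ a : Fin n, a ∈ V1 n ↔ InV1 a := fun a => by simp [V1, InV1]
  have hVset : (V1 n : Set (Fin n)) = {a | InV1 a} := Set.ext hV
  obtain ⟨g, hginj, hgE, himage, hgi⟩ := exists_injOn_image_eq_of_tight (Edge v X r) (V1 n) Sstar f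
    (hVset ▸ hfinj) (fun a ha => (hf a ((hV a).1 ha)).2) hsub
    (by convert hcard; ext; simp [Nbr])
    (fun T hT hTne => by convert hmin T hT hTne; ext; simp [Nbr]) hi hiu
  refine ⟨g, ⟨hVset ▸ hginj, fun a ha => ⟨?_, hgE a ((hV a).2 ha)⟩, fun w hw => ?_⟩, hgi⟩
  · obtain ⟨b, hb, hba⟩ := himage ▸ Set.mem_image_of_mem g (Finset.mem_coe.2 ((hV a).2 ha))
    rw [← hba]
    exact (hf b ((hV b).1 hb)).1
  · obtain ⟨b, hb, rfl⟩ := hfsurj w hw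
    obtain ⟨a, ha, hab⟩ :=
      himage.symm ▸ Set.mem_image_of_mem f (Finset.mem_coe.2 ((hV b).2 hb))
    exact ⟨a, (hV a).1 ha, hab⟩
end
end

section
/- Let X = (X_u)_{u∈V_2} be an allocation to V_2, let u* ∈ V_2∖{r} and g ∈ X_{u*} with |X_{u*}| ≥ 2, and let X' be the allocation obtained from X by moving g to X_r. Then for any i ∈ V_1 and u ∈ V_2∖{u*}, if (i, u) is an edge of G_X, then (i, u) is an edge of G_{X'}. -/
open Finset
open scoped Classical

noncomputable section

variable {G : Type*}

/-- Passing to a nonempty subset of a bundle does not decrease the minimum value of a good. -/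
theorem minval_anti (v : G → ℝ) {S T : Finset G} (hST : S ⊆ T) (hS : S.Nonempty) :
    minval v T ≤ minval v S := by
  rw [minval, minval, dif_pos hS, dif_pos (hS.mono hST)]
  exact Finset.inf'_mono v hST hS

/-- The bundle at `r` does not lose value when a good is moved to it. -/
theorem val_le_val_insert [DecidableEq G] (v : G → ℝ) (hv : ∀ g, 0 ≤ v g) (g : G)
    (S : Finset G) : val v S ≤ val v (insert g S) :=
  Finset.sum_le_sum_of_subset_of_nonneg (Finset.subset_insert g S) fun a _ _ => hv a

/-- Claim 5 in Proposition 1: moving a good `g` out of a bundle of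
size at least `2` preserves all edges `(i, u)` with `u ≠ ustar`. -/
theorem move_preserves_edges {G : Type*} [Fintype G] [DecidableEq G] (n : ℕ) (hn : 2 ≤ n)
    (v : Fin n → G → ℝ) (X : Fin n → Finset G) (r : Fin n)
    (hpos : ∀ (i : Fin n) (g : G), 0 ≤ v i g)
    (hnorm : ∀ i : Fin n, val (v i) (Finset.univ : Finset G) = 1)
    (hX : IsAlloc X)
    (ustar : Fin n) (hustar : ustar ≠ r) (g : G) (hg : g ∈ X ustar)
    (hcard : 2 ≤ (X ustar).card) :
    ∀ i u : Fin n, InV1 i → u ≠ ustar → Edge v X r i u →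
      Edge v (move X r ustar g) r i u := by
  intro i u _ hu hedge
  unfold Edge at *
  refine ge_trans (add_le_add ?_ ?_) hedge
  · by_cases hr : u = r
    · subst hr
      simpa [move] using val_le_val_insert (v i) (hpos i) g (X u)
    · simp [move, hr, hu]
  · have hn' : (2 : ℝ) ≤ n := by exact_mod_cast hn
    refine mul_le_mul_of_nonneg_left (Finset.sum_le_sum fun w hw => ?_)
      (one_div_nonneg.mpr (by linarith))
    have hwr : w ≠ r := Finset.ne_of_mem_erase (Finset.mem_of_mem_erase hw)
    by_cases hwu : w = ustar
    · subst hwu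
      simp only [move, if_neg hwr, if_true]
      refine minval_anti (v i) (Finset.erase_subset g (X w)) (Finset.card_pos.mp ?_)
      rw [Finset.card_erase_of_mem hg]
      omega
    · simp [move, hwr, hwu]
end
end

section
/- Let n ≥ 3 and suppose that v_i(g) ≤ 1/n for every agent i ∈ N and every good g ∈ M. Let (X_1,…,X_{n−1}) be a PROPavg allocation of M to agents {1,…,n−1}, i.e., for every i ∈ {1,…,n−1}, v_i(X_i) ≥ 1/(n−1) − (1/(n−2)) ∑_{j∈{1,…,n−1}∖{i}} m_i(X_j). Then for every i ∈ {1,…,n−1}, v_i(X_i) + (1/(n−1)) ∑_{j∈{1,…,n−1}∖{i}} m_i(X_j) ≥ 1/n; consequently, taking V_2 = {1,…,n} with r = n and X_n = ∅, the allocation X = (X_1,…,X_{n−1},X_n) to V_2 has edge (i, i) in its PROPavg-graph for each i ∈ {1,…,n−1}, and hence satisfies (P1). -/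
open Finset
open scoped Classical

noncomputable section

variable {G : Type*}

/-- An upper bound on the value of every good bounds the minimum value of a bundle. -/
lemma minval_le {v : G → ℝ} {c : ℝ} (hc : 0 ≤ c) (hv : ∀ g, v g ≤ c) (S : Finset G) :
    minval v S ≤ c := by
  unfold minval
  split_ifs with h
  · obtain ⟨g, hg⟩ := h
    exact (Finset.inf'_le v hg).trans (hv g)
  · exact hc

lemma V1_eq_erase {n : ℕ} (hn : 0 < n) :
    V1 n = Finset.univ.erase (⟨n - 1, by omega⟩ : Fin n) := by
  ext j
  simp only [V1, Finset.mem_filter, Finset.mem_univ, true_and, Finset.mem_erase, and_true,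
    ne_eq, Fin.ext_iff]
  omega

lemma card_V1_erase {n : ℕ} (hn : 2 ≤ n) {i : Fin n} (hi : InV1 i) :
    (((V1 n).erase i).card : ℝ) = (n : ℝ) - 2 := by
  have hmem : i ∈ V1 n := by simpa [V1, InV1] using hi
  rw [Finset.card_erase_of_mem hmem, V1_eq_erase (by omega),
    Finset.card_erase_of_mem (Finset.mem_univ _), Finset.card_univ, Fintype.card_fin,
    Nat.sub_sub, Nat.cast_sub hn]
  norm_num

lemma one_div_le_of_propAvg {n a s : ℝ} (hn : 2 < n) (hs : s ≤ (n - 2) * (1 / n))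
    (ha : 1 / (n - 1) - 1 / (n - 2) * s ≤ a) : 1 / n ≤ a + 1 / (n - 1) * s := by
  have h0 : 0 < n := by linarith
  have h1 : 0 < n - 1 := by linarith
  have h2 : 0 < n - 2 := by linarith
  have hmul := mul_le_mul_of_nonneg_left hs (show 0 ≤ 1 / (n - 2) - 1 / (n - 1) by
    rw [sub_nonneg]
    exact one_div_le_one_div_of_le h2 (by linarith))
  have heq : (1 / (n - 2) - 1 / (n - 1)) * ((n - 2) * (1 / n)) = 1 / (n - 1) - 1 / n := by
    field_simp
    ring
  linarith

/-- Lemma 6: if every good has value at most `1/n` for every agent,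
a PROPavg allocation for the first `n-1` agents (padded with an empty bundle at the
last label `r = n`) satisfies (P1), with edge `(i, i)` for every `i ∈ V₁`. -/
theorem recursion_gives_p1 {G : Type*} [Fintype G] (n : ℕ) (hn : 3 ≤ n)
    (v : Fin n → G → ℝ)
    (hpos : ∀ (i : Fin n) (g : G), 0 ≤ v i g)
    (hnorm : ∀ i : Fin n, val (v i) (Finset.univ : Finset G) = 1)
    (hbound : ∀ (i : Fin n) (g : G), v i g ≤ 1 / (n : ℝ))
    (X : Fin n → Finset G)
    (hlast : X (⟨n - 1, by omega⟩ : Fin n) = ∅)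
    (hX : IsAlloc X)
    (hprop : ∀ i : Fin n, InV1 i →
      val (v i) (X i) ≥ 1 / ((n : ℝ) - 1)
        - (1 / ((n : ℝ) - 2)) * ∑ j ∈ (V1 n).erase i, minval (v i) (X j)) :
    (∀ i : Fin n, InV1 i →
      val (v i) (X i) + (1 / ((n : ℝ) - 1)) * ∑ j ∈ (V1 n).erase i, minval (v i) (X j)
        ≥ 1 / (n : ℝ)) ∧
    (∀ i : Fin n, InV1 i → Edge v X (⟨n - 1, by omega⟩ : Fin n) i i) ∧
    P1 v X (⟨n - 1, by omega⟩ : Fin n) := by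
  have hn' : (2 : ℝ) < n := by exact_mod_cast hn
  have hval : ∀ i : Fin n, InV1 i →
      val (v i) (X i) + (1 / ((n : ℝ) - 1)) * ∑ j ∈ (V1 n).erase i, minval (v i) (X j)
        ≥ 1 / (n : ℝ) := by
    intro i hi
    refine one_div_le_of_propAvg hn' ?_ (hprop i hi)
    have hsum := Finset.sum_le_card_nsmul ((V1 n).erase i) (fun j => minval (v i) (X j))
      (1 / (n : ℝ)) fun j _ => minval_le (by positivity) (hbound i) (X j)
    rwa [nsmul_eq_mul, card_V1_erase (by omega) hi] at hsum
  have hedge : ∀ i : Fin n, InV1 i → Edge v X (⟨n - 1, by omega⟩ : Fin n) i i := by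
    intro i hi
    have h := hval i hi
    rwa [V1_eq_erase (by omega)] at h
  refine ⟨hval, hedge, id, Function.injective_id.injOn, fun i hi => ⟨?_, hedge i hi⟩,
    fun w hw => ⟨w, ?_, rfl⟩⟩
  · simp only [InV1] at hi
    simp only [id, ne_eq, Fin.ext_iff]
    omega
  · simp only [ne_eq, Fin.ext_iff] at hw
    simp only [InV1]
    omega
end
end
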